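/- arXiv:1611.00164 — 9 statements merged into one kernel-verified Lean document; each statement's English description precedes it below -/
import Mathlib

section
/- Let h > 0 and let v : ℤ → ℂ be absolutely summable. Then for every j ∈ ℤ, the inversion formula holds: v_j = (1/(2π)) ∫_{−π/h}^{π/h} e^{i ξ j h} v̂(ξ) dξ. -/
open Complex Real

/-- Orthogonality of the characters `ξ ↦ e^{iξnh}` on `[-π/h, π/h]`. -/
theorem integral_exp_I_mul_int_mul (h : ℝ) (hh : 0 < h) (n : ℤ) :
    ∫ ξ : ℝ in (-(π / h))..(π / h), Complex.exp (Complex.I * n * h * ξ) =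
      if n = 0 then 2 * (π : ℂ) / h else 0 := by
  have hc : (h : ℂ) ≠ 0 := Complex.ofReal_ne_zero.mpr hh.ne'
  split_ifs with hn
  · simp only [hn, Int.cast_zero, mul_zero, zero_mul, Complex.exp_zero,
      intervalIntegral.integral_const, Complex.real_smul]
    push_cast
    ring
  · have hn' : (n : ℂ) ≠ 0 := Int.cast_ne_zero.mpr hn
    rw [integral_exp_mul_complex (mul_ne_zero (mul_ne_zero Complex.I_ne_zero hn') hc)]
    have hexp : Complex.exp (Complex.I * n * h * ((π / h : ℝ) : ℂ)) =
        Complex.exp (Complex.I * n * h * ((-(π / h) : ℝ) : ℂ)) := by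
      refine Complex.exp_eq_exp_iff_exists_int.mpr ⟨n, ?_⟩
      push_cast
      field_simp
      ring
    rw [hexp, sub_self, zero_div]

/-- inversion formula for the semi-discrete Fourier transform.
For `h > 0` and absolutely summable `v : ℤ → ℂ`, with
`v̂(ξ) = h·∑_j e^{-iξjh} v_j`, one recovers
`v_j = (1/(2π)) ∫_{-π/h}^{π/h} e^{iξjh} v̂(ξ) dξ`. -/
theorem semi_discrete_fourier_inversion
    (h : ℝ) (hh : 0 < h) (v : ℤ → ℂ)
    (hv : Summable fun j : ℤ => ‖v j‖) :
    ∀ j : ℤ,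
      v j = (1 / (2 * (π : ℂ))) *
        ∫ ξ : ℝ in (-(π / h))..(π / h),
          Complex.exp (Complex.I * ξ * j * h) *
            ((h : ℂ) * ∑' i : ℤ, Complex.exp (-(Complex.I * ξ * i * h)) * v i) := by
  intro j
  have hc : (h : ℂ) ≠ 0 := Complex.ofReal_ne_zero.mpr hh.ne'
  have hπ : (π : ℂ) ≠ 0 := Complex.ofReal_ne_zero.mpr Real.pi_ne_zero
  have hnorm (i : ℤ) (ξ : ℝ) :
      ‖Complex.exp (Complex.I * ((j - i : ℤ) : ℂ) * h * ξ) * (h * v i)‖ = h * ‖v i‖ := by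
    have harg : Complex.I * ((j - i : ℤ) : ℂ) * h * ξ =
        ((((j - i : ℤ) : ℝ) * h * ξ : ℝ) : ℂ) * Complex.I := by
      push_cast
      ring
    rw [norm_mul, harg, Complex.norm_exp_ofReal_mul_I, one_mul, norm_mul, Complex.norm_real,
      Real.norm_of_nonneg hh.le]
  have hsum : Summable fun i : ℤ => h * ‖v i‖ := hv.mul_left h
  have hpoint (ξ : ℝ) :
      Complex.exp (Complex.I * ξ * j * h) *
          ((h : ℂ) * ∑' i : ℤ, Complex.exp (-(Complex.I * ξ * i * h)) * v i) =
        ∑' i : ℤ, Complex.exp (Complex.I * ((j - i : ℤ) : ℂ) * h * ξ) * (h * v i) := by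
    rw [← tsum_mul_left, ← tsum_mul_left]
    refine tsum_congr fun i => ?_
    have harg : Complex.I * ((j - i : ℤ) : ℂ) * h * ξ =
        Complex.I * ξ * j * h + -(Complex.I * ξ * i * h) := by
      push_cast
      ring
    rw [harg, Complex.exp_add]
    ring
  have hswap := intervalIntegral.hasSum_integral_of_dominated_convergence
    (μ := MeasureTheory.volume) (a := -(π / h)) (b := π / h)
    (F := fun (i : ℤ) (ξ : ℝ) =>
      Complex.exp (Complex.I * ((j - i : ℤ) : ℂ) * h * ξ) * (h * v i))
    (fun i _ => h * ‖v i‖)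
    (fun i => Continuous.aestronglyMeasurable (by fun_prop))
    (fun i => .of_forall fun ξ _ => (hnorm i ξ).le)
    (.of_forall fun _ _ => hsum)
    intervalIntegrable_const
    (.of_forall fun ξ _ => (Summable.of_norm (by simpa only [hnorm] using hsum)).hasSum)
  simp only [hpoint]
  rw [← hswap.tsum_eq]
  simp only [intervalIntegral.integral_mul_const, integral_exp_I_mul_int_mul h hh]
  rw [tsum_eq_single j fun i hi => by rw [if_neg (sub_ne_zero.mpr hi.symm), zero_mul],
    if_pos (sub_self j)]
  field_simp
end

section
/- Let w : ℤ → ℝ satisfy w_{−k} = w_k for all k and ∑_{k≠0} |w_k| < ∞, and let u, v : ℤ → ℝ be absolutely summable. Define (Lu)_j = ∑_{k≠0} (u_j − u_{j−k}) w_k and likewise for v. Then the discrete operator is self-adjoint: ∑_{j∈ℤ} (Lu)_j·v_j = ∑_{j∈ℤ} u_j·(Lv)_j, both series converging absolutely. -/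
/-- The off-diagonal part of the bilinear form of the operator is absolutely summable. -/
theorem summable_offDiagonal {w u v : ℤ → ℝ}
    (hw : Summable fun k : {k : ℤ // k ≠ 0} => |w k|)
    (hu : Summable fun j : ℤ => |u j|) (hv : Summable fun j : ℤ => |v j|) :
    Summable fun p : ℤ × {k : ℤ // k ≠ 0} => u (p.1 - p.2) * w p.2 * v p.1 := by
  have huv : Summable fun p : ℤ × ℤ => ‖u p.1 * v p.2‖ :=
    Summable.mul_norm (f := u) (g := v) hu hv
  have huvw : Summable fun p : (ℤ × ℤ) × {k : ℤ // k ≠ 0} =>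
      ‖u p.1.1 * v p.1.2 * w p.2‖ :=
    Summable.mul_norm (f := fun p : ℤ × ℤ => u p.1 * v p.2)
      (g := fun k : {k : ℤ // k ≠ 0} => w k) huv hw
  have hinj : Function.Injective fun p : ℤ × {k : ℤ // k ≠ 0} =>
      (((p.1 - p.2, p.1), p.2) : (ℤ × ℤ) × {k : ℤ // k ≠ 0}) := by
    rintro ⟨i, k⟩ ⟨j, l⟩ h
    simp only [Prod.mk.injEq] at h ⊢
    exact ⟨h.1.2, h.2⟩
  refine (huvw.of_norm.comp_injective hinj).congr fun p => ?_
  simp only [Function.comp_apply]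
  ring

/-- The diagonal part of the bilinear form of the operator is absolutely summable. -/
theorem summable_diagonal {w u v : ℤ → ℝ}
    (hw : Summable fun k : {k : ℤ // k ≠ 0} => |w k|)
    (hu : Summable fun j : ℤ => |u j|) (hv : Summable fun j : ℤ => |v j|) :
    Summable fun p : ℤ × {k : ℤ // k ≠ 0} => u p.1 * w p.2 * v p.1 := by
  have hdiag : Summable fun j : ℤ => ‖u j * v j‖ :=
    (Summable.mul_norm (f := u) (g := v) hu hv).comp_injective (i := fun j : ℤ => (j, j))
      fun i j h => congrArg Prod.fst h
  have hmul : Summable fun p : ℤ × {k : ℤ // k ≠ 0} => ‖u p.1 * v p.1 * w p.2‖ :=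
    Summable.mul_norm (f := fun j : ℤ => u j * v j)
      (g := fun k : {k : ℤ // k ≠ 0} => w k) hdiag hw
  exact hmul.of_norm.congr fun p => by ring

/-- The pairing of `Lu` with `v` is the difference of the diagonal and off-diagonal double sums. -/
theorem hasSum_operator_mul {w u v : ℤ → ℝ}
    (hw : Summable fun k : {k : ℤ // k ≠ 0} => |w k|)
    (hu : Summable fun j : ℤ => |u j|) (hv : Summable fun j : ℤ => |v j|) :
    HasSum (fun j : ℤ => (∑' k : {k : ℤ // k ≠ 0}, (u j - u (j - k)) * w k) * v j)
      (∑' p : ℤ × {k : ℤ // k ≠ 0}, u p.1 * w p.2 * v p.1 -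
        ∑' p : ℤ × {k : ℤ // k ≠ 0}, u (p.1 - p.2) * w p.2 * v p.1) := by
  have h := (summable_diagonal hw hu hv).hasSum.sub (summable_offDiagonal hw hu hv).hasSum
  refine h.prod_fiberwise fun j => ?_
  convert (h.summable.prod_factor j).hasSum using 1
  rw [← tsum_mul_right]
  exact tsum_congr fun k => by ring

/-- For symmetric weights the off-diagonal double sum is symmetric in the two sequences. -/
theorem tsum_offDiagonal_comm {w : ℤ → ℝ} (hw : ∀ k : ℤ, w (-k) = w k) (u v : ℤ → ℝ) :
    ∑' p : ℤ × {k : ℤ // k ≠ 0}, u (p.1 - p.2) * w p.2 * v p.1 =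
      ∑' p : ℤ × {k : ℤ // k ≠ 0}, v (p.1 - p.2) * w p.2 * u p.1 := by
  let f : ℤ × {k : ℤ // k ≠ 0} → ℤ × {k : ℤ // k ≠ 0} :=
    fun p => (p.1 - p.2, ⟨-p.2, neg_ne_zero.mpr p.2.2⟩)
  have hf : Function.Involutive f := fun p => by
    ext <;> simp [f]
  rw [← hf.toPerm.tsum_eq]
  refine tsum_congr fun p => ?_
  simp only [Function.Involutive.coe_toPerm, f, hw, sub_neg_eq_add, sub_add_cancel]
  ring

/-- the discrete fractional-Laplacian-type operator
`(Lu)_j = ∑_{k≠0} (u_j - u_{j-k}) w_k` with symmetric, absolutely summable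
weights is self-adjoint on absolutely summable real sequences:
`∑_j (Lu)_j v_j = ∑_j u_j (Lv)_j`, both series converging absolutely. -/
theorem discrete_operator_self_adjoint
    (w : ℤ → ℝ)
    (hwsym : ∀ k : ℤ, w (-k) = w k)
    (hwsum : Summable fun k : {k : ℤ // k ≠ 0} => |w k|)
    (u v : ℤ → ℝ)
    (hu : Summable fun j : ℤ => |u j|) (hv : Summable fun j : ℤ => |v j|)
    (Lu Lv : ℤ → ℝ)
    (hLu : ∀ j : ℤ, Lu j = ∑' k : {k : ℤ // k ≠ 0}, (u j - u (j - k)) * w k)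
    (hLv : ∀ j : ℤ, Lv j = ∑' k : {k : ℤ // k ≠ 0}, (v j - v (j - k)) * w k) :
    (Summable fun j : ℤ => |Lu j * v j|) ∧
    (Summable fun j : ℤ => |u j * Lv j|) ∧
    ∑' j : ℤ, Lu j * v j = ∑' j : ℤ, u j * Lv j := by
  have hLuv := hasSum_operator_mul hwsum hu hv
  have hLvu := hasSum_operator_mul hwsum hv hu
  simp only [← hLu] at hLuv
  simp only [← hLv, mul_comm (Lv _)] at hLvu
  refine ⟨hLuv.summable.abs, hLvu.summable.abs, ?_⟩
  rw [hLuv.tsum_eq, hLvu.tsum_eq, tsum_offDiagonal_comm hwsym u v]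
  congr 1
  exact tsum_congr fun p => by ring
end

section
/- Let w : ℤ → ℝ satisfy w_{−k} = w_k for all k, w_k ≥ 0 for all k ≠ 0, and ∑_{k≠0} |w_k| < ∞, and let u : ℤ → ℝ be square-summable. Define (Lu)_j = ∑_{k≠0} (u_j − u_{j−k}) w_k. Then the discrete energy is non-negative: ∑_{j∈ℤ} (Lu)_j·u_j ≥ 0. -/
/-- For a square-summable `u`, the pairing of `u - u (· - k)` with `u` is non-negative. -/
theorem tsum_sub_shift_mul_self_nonneg {u : ℤ → ℝ} (hu : Summable fun j => u j ^ 2) (k : ℤ) :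
    0 ≤ ∑' j, (u j - u (j - k)) * u j := by
  have hshift : Summable fun j => u (j - k) ^ 2 := (Equiv.subRight k).summable_iff.mpr hu
  have hshift_tsum : ∑' j, u (j - k) ^ 2 = ∑' j, u j ^ 2 :=
    (Equiv.subRight k).tsum_eq fun j => u j ^ 2
  have hsum : Summable fun j => (u j - u (j - k)) * u j := by
    refine Summable.of_norm_bounded ((hu.mul_left 2).add hshift) fun j => ?_
    rw [Real.norm_eq_abs, abs_le]
    constructor <;> nlinarith [sq_nonneg (u j + u (j - k)), sq_nonneg (u j - u (j - k)),
      sq_nonneg (u j), sq_nonneg (u (j - k))]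
  calc 0 = ∑' j, 2⁻¹ * (u j ^ 2 - u (j - k) ^ 2) := by
        rw [tsum_mul_left, hu.tsum_sub hshift, hshift_tsum, sub_self, mul_zero]
    _ ≤ ∑' j, (u j - u (j - k)) * u j :=
        ((hu.sub hshift).mul_left _).tsum_le_tsum
          (fun j => by nlinarith [sq_nonneg (u j - u (j - k))]) hsum

/-- The terms of the discrete energy are absolutely summable over both indices. -/
theorem summable_sub_shift_mul_weight_mul_self {s : Set ℤ} {w u : ℤ → ℝ}
    (hw : Summable fun k : s => |w k|) (hu : Summable fun j => u j ^ 2) :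
    Summable fun p : ℤ × s => (u p.1 - u (p.1 - p.2)) * w p.2 * u p.1 := by
  have hprod : Summable fun p : ℤ × s => u p.1 ^ 2 * |w p.2| :=
    hu.mul_of_nonneg hw (fun j => sq_nonneg _) fun k => abs_nonneg _
  let e : ℤ × s ≃ ℤ × s :=
    { toFun := fun p => (p.1 - p.2, p.2)
      invFun := fun p => (p.1 + p.2, p.2)
      left_inv := fun p => by simp
      right_inv := fun p => by simp }
  have hshear : Summable fun p : ℤ × s => u (p.1 - p.2) ^ 2 * |w p.2| := e.summable_iff.mpr hprod
  refine Summable.of_norm_bounded ((hprod.mul_left 2).add hshear) fun p => ?_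
  have h : |(u p.1 - u (p.1 - p.2)) * u p.1| ≤ 2 * u p.1 ^ 2 + u (p.1 - p.2) ^ 2 := by
    rw [abs_le]
    constructor <;> nlinarith [sq_nonneg (u p.1 + u (p.1 - p.2)),
      sq_nonneg (u p.1 - u (p.1 - p.2)), sq_nonneg (u p.1), sq_nonneg (u (p.1 - p.2))]
  calc ‖(u p.1 - u (p.1 - p.2)) * w p.2 * u p.1‖
      = |(u p.1 - u (p.1 - p.2)) * u p.1| * |w p.2| := by
        rw [Real.norm_eq_abs, mul_right_comm, abs_mul]
    _ ≤ (2 * u p.1 ^ 2 + u (p.1 - p.2) ^ 2) * |w p.2| := by gcongr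
    _ = _ := by ring

/-- non-negativity of the discrete energy.  For symmetric,
absolutely summable weights that are non-negative off the origin and a
square-summable `u`, the discrete energy `∑_j (Lu)_j u_j` is non-negative. -/
theorem discrete_energy_nonneg
    (w : ℤ → ℝ)
    (hwsym : ∀ k : ℤ, w (-k) = w k)
    (hwpos : ∀ k : ℤ, k ≠ 0 → 0 ≤ w k)
    (hwsum : Summable fun k : {k : ℤ // k ≠ 0} => |w k|)
    (u : ℤ → ℝ)
    (hu : Summable fun j : ℤ => u j ^ 2)
    (Lu : ℤ → ℝ)
    (hLu : ∀ j : ℤ, Lu j = ∑' k : {k : ℤ // k ≠ 0}, (u j - u (j - k)) * w k) :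
    0 ≤ ∑' j : ℤ, Lu j * u j := by
  have hsum := summable_sub_shift_mul_weight_mul_self (s := {k | k ≠ 0}) hwsum hu
  calc 0 ≤ ∑' k : {k : ℤ // k ≠ 0}, ∑' j, (u j - u (j - k)) * w k * u j := by
        refine tsum_nonneg fun k => ?_
        simp_rw [mul_right_comm _ (w k), tsum_mul_right]
        exact mul_nonneg (tsum_sub_shift_mul_self_nonneg hu k) (hwpos k k.2)
    _ = ∑' j, ∑' k : {k : ℤ // k ≠ 0}, (u j - u (j - k)) * w k * u j := Summable.tsum_comm hsum
    _ = ∑' j, Lu j * u j := by simp_rw [hLu, tsum_mul_right]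
end

section
/- Let p > 1, let w : ℤ → ℝ satisfy w_k ≥ 0 for all k ≠ 0 and ∑_{k≠0} w_k < ∞, and let u : ℤ → ℝ be bounded. Define (Lu)_j = ∑_{k≠0} (u_j − u_{j−k}) w_k, and set v_j = |u_j|^p. Then for every j ∈ ℤ the pointwise estimate holds: sgn(u_j)·|u_j|^{p−1}·(Lu)_j ≥ (1/p)·(Lv)_j. -/
/-- The tangent-line inequality for the convex function `t ↦ |t| ^ p / p`. -/
theorem abs_rpow_sub_abs_rpow_div_le {p : ℝ} (hp : 1 < p) (a b : ℝ) :
    1 / p * (|a| ^ p - |b| ^ p) ≤ Real.sign a * |a| ^ (p - 1) * (a - b) := by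
  have hp0 : 0 < p := by linarith
  have hpq : p.HolderConjugate p.conjExponent := Real.HolderConjugate.conjExponent hp
  have young := Real.young_inequality b (Real.sign a * |a| ^ (p - 1)) hpq
  have self_mul : Real.sign a * |a| ^ (p - 1) * a = |a| ^ p := by
    have sign_mul_self : Real.sign a * a = |a| := by
      rcases lt_trichotomy a 0 with ha | rfl | ha
      · simp [Real.sign_of_neg ha, abs_of_neg ha]
      · simp
      · simp [Real.sign_of_pos ha, abs_of_pos ha]
    rw [mul_right_comm, sign_mul_self, mul_comm,
      ← Real.rpow_add_one' (abs_nonneg a) (by simpa using hp0.ne'), sub_add_cancel]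
  have abs_rpow : |Real.sign a * |a| ^ (p - 1)| ^ p.conjExponent = |a| ^ p := by
    have abs_eq : |Real.sign a * |a| ^ (p - 1)| = |a| ^ (p - 1) := by
      rw [abs_mul, abs_of_nonneg (Real.rpow_nonneg (abs_nonneg a) _)]
      rcases lt_trichotomy a 0 with ha | rfl | ha
      · simp [Real.sign_of_neg ha]
      · simp [Real.zero_rpow (sub_ne_zero.2 hp.ne')]
      · simp [Real.sign_of_pos ha]
    rw [abs_eq, ← Real.rpow_mul (abs_nonneg a), hpq.sub_one_mul_conj]
  have inv_add : 1 / p + 1 / p.conjExponent = 1 := by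
    simpa using hpq.inv_add_inv_eq_one
  have split : |a| ^ p = |a| ^ p / p + |a| ^ p / p.conjExponent := by
    linear_combination -|a| ^ p * inv_add
  rw [abs_rpow] at young
  rw [mul_sub, mul_sub, self_mul, one_div_mul_eq_div, one_div_mul_eq_div]
  linarith

/-- Differences of a bounded function are summable against nonnegative summable weights. -/
theorem summable_sub_mul_of_abs_le {s : Set ℤ} {w : ℤ → ℝ} (hw : ∀ k ∈ s, 0 ≤ w k)
    (hws : Summable fun k : s => w k) {f : ℤ → ℝ} {C : ℝ} (hf : ∀ j, |f j| ≤ C) (j : ℤ) :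
    Summable fun k : s => (f j - f (j - k)) * w k := by
  refine Summable.of_norm_bounded (hws.mul_left (C + C)) fun k => ?_
  rw [Real.norm_eq_abs, abs_mul, abs_of_nonneg (hw k k.2)]
  exact mul_le_mul_of_nonneg_right ((abs_sub _ _).trans (add_le_add (hf _) (hf _))) (hw k k.2)

/-- the Córdoba–Córdoba-type pointwise estimate.  For `p > 1`,
non-negative summable weights, and bounded `u`, with `v_j = |u_j|^p`,
`sgn(u_j)·|u_j|^{p-1}·(Lu)_j ≥ (1/p)·(Lv)_j` pointwise, where
`sgn(t)·|t|^{p-1}` equals `|t|^{p-2}t` for `t ≠ 0` and `0` at `t = 0`. -/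
theorem discrete_pointwise_cordoba_estimate
    (p : ℝ) (hp : 1 < p)
    (w : ℤ → ℝ)
    (hwpos : ∀ k : ℤ, k ≠ 0 → 0 ≤ w k)
    (hwsum : Summable fun k : {k : ℤ // k ≠ 0} => w k)
    (u : ℤ → ℝ) (hu : ∃ C : ℝ, ∀ j : ℤ, |u j| ≤ C)
    (v : ℤ → ℝ) (hv : ∀ j : ℤ, v j = |u j| ^ p)
    (Lu Lv : ℤ → ℝ)
    (hLu : ∀ j : ℤ, Lu j = ∑' k : {k : ℤ // k ≠ 0}, (u j - u (j - k)) * w k)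
    (hLv : ∀ j : ℤ, Lv j = ∑' k : {k : ℤ // k ≠ 0}, (v j - v (j - k)) * w k) :
    ∀ j : ℤ, Real.sign (u j) * |u j| ^ (p - 1) * Lu j ≥ (1 / p) * Lv j := by
  intro j
  obtain ⟨C, hC⟩ := hu
  have hvC : ∀ i, |v i| ≤ C ^ p := fun i => by
    rw [hv, abs_of_nonneg (Real.rpow_nonneg (abs_nonneg _) _)]
    exact Real.rpow_le_rpow (abs_nonneg _) (hC i) (by linarith)
  have hsu := summable_sub_mul_of_abs_le (s := {k | k ≠ 0}) hwpos hwsum hC j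
  have hsv := summable_sub_mul_of_abs_le (s := {k | k ≠ 0}) hwpos hwsum hvC j
  rw [ge_iff_le, hLu, hLv, ← tsum_mul_left, ← tsum_mul_left]
  refine Summable.tsum_le_tsum (fun k => ?_) (hsv.mul_left _) (hsu.mul_left _)
  rw [← mul_assoc, ← mul_assoc, hv, hv]
  exact mul_le_mul_of_nonneg_right (abs_rpow_sub_abs_rpow_div_le hp _ _) (hwpos k k.2)
end

section
/- Let p > 2, let w : ℤ → ℝ satisfy w_k ≥ 0 for all k ≠ 0 and ∑_{k≠0} w_k < ∞, and let u : ℤ → ℝ be absolutely summable. Define (Lu)_j = ∑_{k≠0} (u_j − u_{j−k}) w_k, and let φ_j = |u_j|^{p/2}. Then the discrete Stroock–Varopoulos inequality holds: ∑_{j∈ℤ} sgn(u_j)·|u_j|^{p−1}·(Lu)_j ≥ (2/p)·∑_{j∈ℤ} φ_j·(Lφ)_j, both series converging absolutely. -/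
theorem rpow_sub_one_mul_sub_ge {q x y : ℝ} (hq : 1 ≤ q) (hx : 0 < x) (hy : 0 ≤ y) :
    1 / q * (x ^ q * (x ^ q - y ^ q)) ≤ x ^ (2 * q - 1) * (x - y) := by
  have hq0 : 0 < q := by linarith
  obtain ⟨t, ht, rfl⟩ : ∃ t, 0 ≤ t ∧ y = x * t := ⟨y / x, by positivity, by field_simp⟩
  have bernoulli : 1 + q * (t - 1) ≤ t ^ q := by
    simpa using one_add_mul_self_le_rpow_one_add (s := t - 1) (by linarith) hq
  have hsq : x ^ (2 * q - 1) * x = x ^ q * x ^ q := by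
    rw [← Real.rpow_add_one hx.ne', ← Real.rpow_add hx]
    congr 1
    ring
  rw [Real.mul_rpow hx.le ht]
  calc 1 / q * (x ^ q * (x ^ q - x ^ q * t ^ q))
      = x ^ q * x ^ q * (1 / q * (1 - t ^ q)) := by ring
    _ ≤ x ^ q * x ^ q * (1 - t) := by
        gcongr
        rw [one_div, inv_mul_le_iff₀ hq0]
        linarith
    _ = x ^ (2 * q - 1) * (x - x * t) := by rw [← hsq]; ring

theorem sign_mul_abs_rpow_mul_sub_ge {p : ℝ} (hp : 2 < p) (a b : ℝ) :
    2 / p * (|a| ^ (p / 2) * (|a| ^ (p / 2) - |b| ^ (p / 2))) ≤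
      Real.sign a * |a| ^ (p - 1) * (a - b) := by
  rcases eq_or_ne a 0 with rfl | ha
  · simp [Real.zero_rpow (show p / 2 ≠ 0 by linarith)]
  have key := rpow_sub_one_mul_sub_ge (q := p / 2) (by linarith) (abs_pos.2 ha) (abs_nonneg b)
  rw [one_div_div, mul_div_cancel₀ p two_ne_zero] at key
  have hsign : |a| - |b| ≤ Real.sign a * (a - b) := by
    rcases lt_or_gt_of_ne ha with h | h
    · rw [Real.sign_of_neg h, abs_of_neg h]
      linarith [neg_abs_le b]
    · rw [Real.sign_of_pos h, abs_of_pos h]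
      linarith [le_abs_self b]
  calc _ ≤ |a| ^ (p - 1) * (|a| - |b|) := key
    _ ≤ |a| ^ (p - 1) * (Real.sign a * (a - b)) := by gcongr
    _ = _ := by ring

theorem Summable.abs_rpow {ι : Type*} {u : ι → ℝ} (hu : Summable fun j => |u j|) {r : ℝ}
    (hr : 1 ≤ r) : Summable fun j => |u j| ^ r := by
  refine Summable.of_nonneg_of_le (fun j => by positivity) (fun j => ?_)
    (hu.mul_left ((∑' i, |u i|) ^ (r - 1)))
  rcases eq_or_ne (u j) 0 with h | h
  · simp [h, Real.zero_rpow (show r ≠ 0 by linarith)]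
  calc |u j| ^ r = |u j| ^ (r - 1) * |u j| := by
        rw [← Real.rpow_add_one (abs_ne_zero.2 h), sub_add_cancel]
    _ ≤ (∑' i, |u i|) ^ (r - 1) * |u j| := by
        gcongr
        exact hu.le_tsum j fun i _ => abs_nonneg _

theorem abs_sub_mul_weight_le {w f : ℤ → ℝ} (hw : ∀ k : ℤ, k ≠ 0 → 0 ≤ w k)
    (hf : Summable fun j => |f j|) (j : ℤ) (k : {k : ℤ // k ≠ 0}) :
    ‖(f j - f (j - k)) * w k‖ ≤ 2 * (∑' i, |f i|) * w k := by
  have hbound : ∀ i, |f i| ≤ ∑' i, |f i| := fun i => hf.le_tsum i fun _ _ => abs_nonneg _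
  rw [Real.norm_eq_abs, abs_mul, abs_of_nonneg (hw k k.2)]
  refine mul_le_mul_of_nonneg_right ?_ (hw k k.2)
  linarith [abs_sub (f j) (f (j - k)), hbound j, hbound (j - k)]

theorem summable_sub_mul_weight {w f : ℤ → ℝ} (hw : ∀ k : ℤ, k ≠ 0 → 0 ≤ w k)
    (hws : Summable fun k : {k : ℤ // k ≠ 0} => w k) (hf : Summable fun j => |f j|) (j : ℤ) :
    Summable fun k : {k : ℤ // k ≠ 0} => (f j - f (j - k)) * w k :=
  Summable.of_norm_bounded (hws.mul_left _) (abs_sub_mul_weight_le hw hf j)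

theorem summable_abs_mul_tsum_sub_mul_weight {w f : ℤ → ℝ} (hw : ∀ k : ℤ, k ≠ 0 → 0 ≤ w k)
    (hws : Summable fun k : {k : ℤ // k ≠ 0} => w k) (hf : Summable fun j => |f j|)
    {g : ℤ → ℝ} (hg : Summable fun j => |g j|) :
    Summable fun j => |g j * ∑' k : {k : ℤ // k ≠ 0}, (f j - f (j - k)) * w k| := by
  refine Summable.of_nonneg_of_le (fun _ => abs_nonneg _) (fun j => ?_)
    (hg.mul_right (∑' k : {k : ℤ // k ≠ 0}, 2 * (∑' i, |f i|) * w k))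
  rw [abs_mul]
  gcongr
  exact tsum_of_norm_bounded (hws.mul_left _).hasSum (abs_sub_mul_weight_le hw hf j)

/-- discrete Stroock–Varopoulos inequality.  For `p > 2`,
non-negative summable weights and absolutely summable `u`, with
`φ_j = |u_j|^{p/2}`,
`∑_j sgn(u_j)|u_j|^{p-1}(Lu)_j ≥ (2/p) ∑_j φ_j (Lφ)_j`, both series
converging absolutely. -/
theorem discrete_stroock_varopoulos
    (p : ℝ) (hp : 2 < p)
    (w : ℤ → ℝ)
    (hwpos : ∀ k : ℤ, k ≠ 0 → 0 ≤ w k)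
    (hwsum : Summable fun k : {k : ℤ // k ≠ 0} => w k)
    (u : ℤ → ℝ) (hu : Summable fun j : ℤ => |u j|)
    (φ : ℤ → ℝ) (hφ : ∀ j : ℤ, φ j = |u j| ^ (p / 2))
    (Lu Lφ : ℤ → ℝ)
    (hLu : ∀ j : ℤ, Lu j = ∑' k : {k : ℤ // k ≠ 0}, (u j - u (j - k)) * w k)
    (hLφ : ∀ j : ℤ, Lφ j = ∑' k : {k : ℤ // k ≠ 0}, (φ j - φ (j - k)) * w k) :
    (Summable fun j : ℤ => |Real.sign (u j) * |u j| ^ (p - 1) * Lu j|) ∧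
    (Summable fun j : ℤ => |φ j * Lφ j|) ∧
    ∑' j : ℤ, Real.sign (u j) * |u j| ^ (p - 1) * Lu j ≥
      (2 / p) * ∑' j : ℤ, φ j * Lφ j := by
  have hφs : Summable fun j => |φ j| := by
    simpa only [hφ, abs_of_nonneg (Real.rpow_nonneg (abs_nonneg _) _)] using
      hu.abs_rpow (show 1 ≤ p / 2 by linarith)
  have hgs : Summable fun j => |Real.sign (u j) * |u j| ^ (p - 1)| := by
    refine Summable.of_nonneg_of_le (fun _ => abs_nonneg _) (fun j => ?_)
      (hu.abs_rpow (show 1 ≤ p - 1 by linarith))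
    rw [abs_mul, abs_of_nonneg (Real.rpow_nonneg (abs_nonneg (u j)) _)]
    refine mul_le_of_le_one_left (by positivity) ?_
    rcases Real.sign_apply_eq (u j) with h | h | h <;> simp [h]
  have hleft : Summable fun j => |Real.sign (u j) * |u j| ^ (p - 1) * Lu j| := by
    simpa only [hLu] using summable_abs_mul_tsum_sub_mul_weight hwpos hwsum hu hgs
  have hright : Summable fun j => |φ j * Lφ j| := by
    simpa only [hLφ] using summable_abs_mul_tsum_sub_mul_weight hwpos hwsum hφs hφs
  refine ⟨hleft, hright, ?_⟩
  rw [ge_iff_le, ← tsum_mul_left]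
  refine (hright.of_abs.mul_left _).tsum_le_tsum (fun j => ?_) hleft.of_abs
  have hsu := summable_sub_mul_weight hwpos hwsum hu j
  have hsφ := summable_sub_mul_weight hwpos hwsum hφs j
  rw [hLu, hLφ, ← tsum_mul_left, ← tsum_mul_left, ← tsum_mul_left]
  refine ((hsφ.mul_left _).mul_left _).tsum_le_tsum (fun k => ?_) (hsu.mul_left _)
  calc 2 / p * (φ j * ((φ j - φ (j - k)) * w k))
      = 2 / p * (φ j * (φ j - φ (j - k))) * w k := by ring
    _ ≤ Real.sign (u j) * |u j| ^ (p - 1) * (u j - u (j - k)) * w k := by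
        refine mul_le_mul_of_nonneg_right ?_ (hwpos k k.2)
        simpa only [hφ] using sign_mul_abs_rpow_mul_sub_ge hp (u j) (u (j - k))
    _ = _ := by ring
end

section
/- Let w : ℤ → ℝ satisfy w_k > 0 for all k ≠ 0 and ∑_{k≠0} w_k < ∞, let D ⊂ ℤ be a finite nonempty set with nonempty complement, and let u : ℤ → ℝ be bounded. Define (Lu)_j = ∑_{k≠0} (u_j − u_{j−k}) w_k. If (Lu)_j ≤ 0 for every j ∈ D, then the discrete maximum principle holds: max_{j∈D} u_j ≤ sup_{j∉D} u_j. Similarly, if (Lu)_j ≥ 0 for every j ∈ D, then min_{j∈D} u_j ≥ inf_{j∉D} u_j. -/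
/-- At a strict-somewhere global maximum of a bounded function, the nonlocal operator with
positive summable weights is positive. -/
theorem tsum_sub_mul_pos_of_isMax
    {w : ℤ → ℝ} (hwpos : ∀ k : ℤ, k ≠ 0 → 0 < w k)
    (hwsum : Summable fun k : {k : ℤ // k ≠ 0} => w k)
    {u : ℤ → ℝ} {C : ℝ} (hu : ∀ j : ℤ, |u j| ≤ C) {m i : ℤ}
    (hmax : ∀ j, u j ≤ u m) (hi : u i < u m) :
    0 < ∑' k : {k : ℤ // k ≠ 0}, (u m - u (m - k)) * w k := by
  have hne : m - i ≠ 0 := by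
    intro h
    rw [sub_eq_zero.mp h] at hi
    exact lt_irrefl _ hi
  have hnonneg : ∀ k : {k : ℤ // k ≠ 0}, 0 ≤ (u m - u (m - k)) * w k := fun k =>
    mul_nonneg (sub_nonneg.mpr (hmax _)) (hwpos k k.2).le
  have hsum : Summable fun k : {k : ℤ // k ≠ 0} => (u m - u (m - k)) * w k := by
    refine Summable.of_nonneg_of_le hnonneg (fun k => ?_) (hwsum.mul_left (2 * C))
    refine mul_le_mul_of_nonneg_right ?_ (hwpos k k.2).le
    linarith [(abs_le.mp (hu m)).2, (abs_le.mp (hu (m - k))).1]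
  refine hsum.tsum_pos hnonneg ⟨m - i, hne⟩ (mul_pos ?_ (hwpos _ hne))
  simpa using hi

/-- A bounded subsolution of the nonlocal operator on a finite set is bounded there by any
upper bound for its values on the complement. -/
theorem le_of_forall_notMem_le_of_tsum_nonpos
    {w : ℤ → ℝ} (hwpos : ∀ k : ℤ, k ≠ 0 → 0 < w k)
    (hwsum : Summable fun k : {k : ℤ // k ≠ 0} => w k)
    {D : Finset ℤ} (hDc : ((↑D : Set ℤ)ᶜ).Nonempty)
    {u : ℤ → ℝ} {C : ℝ} (hu : ∀ j : ℤ, |u j| ≤ C)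
    (hLu : ∀ j ∈ D, ∑' k : {k : ℤ // k ≠ 0}, (u j - u (j - k)) * w k ≤ 0)
    {S : ℝ} (hS : ∀ j ∉ D, u j ≤ S) {j : ℤ} (hj : j ∈ D) : u j ≤ S := by
  obtain ⟨m, hm, hmax⟩ := D.exists_max_image u ⟨j, hj⟩
  refine (hmax j hj).trans ?_
  by_contra! hlt
  obtain ⟨i, hi⟩ := hDc
  have hi' : i ∉ D := by simpa using hi
  refine (hLu m hm).not_gt
    (tsum_sub_mul_pos_of_isMax hwpos hwsum hu (fun l => ?_) ((hS i hi').trans_lt hlt))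
  by_cases hl : l ∈ D
  · exact hmax l hl
  · exact (hS l hl).trans hlt.le

/-- discrete maximum principle.  For strictly positive summable
weights, a finite nonempty `D ⊂ ℤ` with nonempty complement, and bounded `u`:
if `(Lu)_j ≤ 0` on `D` then `max_{j∈D} u_j ≤ sup_{j∉D} u_j`, and if
`(Lu)_j ≥ 0` on `D` then `min_{j∈D} u_j ≥ inf_{j∉D} u_j`. -/
theorem discrete_maximum_principle
    (w : ℤ → ℝ)
    (hwpos : ∀ k : ℤ, k ≠ 0 → 0 < w k)
    (hwsum : Summable fun k : {k : ℤ // k ≠ 0} => w k)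
    (D : Finset ℤ) (hD : D.Nonempty) (hDc : ((↑D : Set ℤ)ᶜ).Nonempty)
    (u : ℤ → ℝ) (hu : ∃ C : ℝ, ∀ j : ℤ, |u j| ≤ C)
    (Lu : ℤ → ℝ)
    (hLu : ∀ j : ℤ, Lu j = ∑' k : {k : ℤ // k ≠ 0}, (u j - u (j - k)) * w k) :
    ((∀ j ∈ D, Lu j ≤ 0) → D.sup' hD u ≤ ⨆ j : {j : ℤ // j ∉ D}, u j) ∧
    ((∀ j ∈ D, 0 ≤ Lu j) → D.inf' hD u ≥ ⨅ j : {j : ℤ // j ∉ D}, u j) := by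
  obtain ⟨C, hC⟩ := hu
  refine ⟨fun h => Finset.sup'_le hD u fun j hj => ?_,
    fun h => Finset.le_inf' hD u fun j hj => ?_⟩
  · have hbdd : BddAbove (Set.range fun j : {j : ℤ // j ∉ D} => u j) :=
      ⟨C, by rintro _ ⟨i, rfl⟩; exact (abs_le.mp (hC i)).2⟩
    exact le_of_forall_notMem_le_of_tsum_nonpos hwpos hwsum hDc hC
      (fun i hi => hLu i ▸ h i hi) (fun i hi => le_ciSup hbdd ⟨i, hi⟩) hj
  · have hbdd : BddBelow (Set.range fun j : {j : ℤ // j ∉ D} => u j) :=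
      ⟨-C, by rintro _ ⟨i, rfl⟩; exact (abs_le.mp (hC i)).1⟩
    refine neg_le_neg_iff.mp (le_of_forall_notMem_le_of_tsum_nonpos (u := fun i => -u i)
      hwpos hwsum hDc (fun i => (abs_neg (u i)).trans_le (hC i)) (fun i hi => ?_)
      (fun i hi => neg_le_neg (ciInf_le hbdd ⟨i, hi⟩)) hj)
    have hneg : ∀ k : {k : ℤ // k ≠ 0},
        (-u i - -u (i - k)) * w k = -((u i - u (i - k)) * w k) := fun k => by ring
    simp only [hneg, tsum_neg, ← hLu i]
    exact neg_nonpos.mpr (h i hi)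
end

section
/- Let w : ℤ → ℝ satisfy w_k > 0 for all k ≠ 0 and ∑_{k≠0} w_k < ∞, and let D ⊂ ℤ be a finite nonempty set with nonempty complement. Suppose v : ℤ → ℝ is a bounded discrete supersolution, i.e. (Lv)_j ≥ 1 for every j ∈ D and v_j ≥ 0 for every j ∉ D. Let e : ℤ → ℝ be bounded with e_j = 0 for every j ∉ D, and set r_j = (Le)_j for j ∈ D. Then the numerical error is controlled by the truncation error: for every j ∈ ℤ, |e_j| ≤ (max_{i∈D} |r_i|)·(sup_{i∈ℤ} v_i). -/
/-- The differences of a bounded sequence are summable against summable weights. -/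
theorem summable_sub_mul_of_bounded {w : ℤ → ℝ} (hwpos : ∀ k : ℤ, k ≠ 0 → 0 < w k)
    (hwsum : Summable fun k : {k : ℤ // k ≠ 0} => w k) {u : ℤ → ℝ}
    (hu : ∃ C : ℝ, ∀ j : ℤ, |u j| ≤ C) (j : ℤ) :
    Summable fun k : {k : ℤ // k ≠ 0} => (u j - u (j - k)) * w k := by
  obtain ⟨C, hC⟩ := hu
  refine Summable.of_norm_bounded (hwsum.mul_left (C + C)) fun k => ?_
  rw [Real.norm_eq_abs, abs_mul, abs_of_pos (hwpos k k.2)]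
  exact mul_le_mul_of_nonneg_right
    ((abs_sub _ _).trans (add_le_add (hC _) (hC _))) (hwpos k k.2).le

/-- Discrete minimum principle: a supersolution that is nonnegative off `D` is nonnegative. -/
theorem nonneg_of_discrete_supersolution {w : ℤ → ℝ} (hwpos : ∀ k : ℤ, k ≠ 0 → 0 < w k)
    {D : Finset ℤ} (hDc : ((↑D : Set ℤ)ᶜ).Nonempty) {u : ℤ → ℝ}
    (hsum : ∀ j ∈ D, Summable fun k : {k : ℤ // k ≠ 0} => (u j - u (j - k)) * w k)
    (hsuper : ∀ j ∈ D, 0 ≤ ∑' k : {k : ℤ // k ≠ 0}, (u j - u (j - k)) * w k)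
    (hout : ∀ j : ℤ, j ∉ D → 0 ≤ u j) (j : ℤ) : 0 ≤ u j := by
  by_contra! hj
  have hjD : j ∈ D := by
    by_contra h
    exact (hout j h).not_gt hj
  obtain ⟨i, hiD, hi⟩ := D.exists_min_image u ⟨j, hjD⟩
  have hineg : u i < 0 := (hi j hjD).trans_lt hj
  have hmin (m : ℤ) : u i ≤ u m := by
    by_cases hm : m ∈ D
    · exact hi m hm
    · exact hineg.le.trans (hout m hm)
  obtain ⟨m, hm⟩ := hDc
  have hmD : m ∉ D := by simpa using hm
  have hne : i - m ≠ 0 := fun h => hmD (sub_eq_zero.mp h ▸ hiD)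
  have hlt : ∑' k : {k : ℤ // k ≠ 0}, (u i - u (i - k)) * w k
      < ∑' _ : {k : ℤ // k ≠ 0}, (0 : ℝ) := by
    refine Summable.tsum_lt_tsum (i := ⟨i - m, hne⟩) (fun k => ?_) ?_ (hsum i hiD) summable_zero
    · exact mul_nonpos_of_nonpos_of_nonneg (sub_nonpos.mpr (hmin _)) (hwpos k k.2).le
    · refine mul_neg_of_neg_of_pos ?_ (hwpos _ hne)
      rw [sub_sub_cancel]
      linarith [hout m hmD]
  rw [tsum_zero] at hlt
  exact (hsuper i hiD).not_gt hlt

/-- error bound by a discrete supersolution (barrier argument).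
For strictly positive summable weights, finite nonempty `D ⊂ ℤ` with nonempty
complement, a bounded supersolution `v` with `(Lv)_j ≥ 1` on `D` and `v_j ≥ 0`
off `D`, and a bounded `e` vanishing off `D` with residual `r_j = (Le)_j`,
the error satisfies `|e_j| ≤ (max_{i∈D} |r_i|)·(sup_i v_i)` for all `j`. -/
theorem discrete_barrier_error_bound
    (w : ℤ → ℝ)
    (hwpos : ∀ k : ℤ, k ≠ 0 → 0 < w k)
    (hwsum : Summable fun k : {k : ℤ // k ≠ 0} => w k)
    (D : Finset ℤ) (hD : D.Nonempty) (hDc : ((↑D : Set ℤ)ᶜ).Nonempty)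
    (v : ℤ → ℝ) (hv : ∃ C : ℝ, ∀ j : ℤ, |v j| ≤ C)
    (Lv : ℤ → ℝ)
    (hLv : ∀ j : ℤ, Lv j = ∑' k : {k : ℤ // k ≠ 0}, (v j - v (j - k)) * w k)
    (hsuper : ∀ j ∈ D, 1 ≤ Lv j)
    (hvout : ∀ j : ℤ, j ∉ D → 0 ≤ v j)
    (e : ℤ → ℝ) (he : ∃ C : ℝ, ∀ j : ℤ, |e j| ≤ C)
    (heout : ∀ j : ℤ, j ∉ D → e j = 0)
    (r : ℤ → ℝ)
    (hr : ∀ j : ℤ, r j = ∑' k : {k : ℤ // k ≠ 0}, (e j - e (j - k)) * w k) :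
    ∀ j : ℤ, |e j| ≤ (D.sup' hD fun i => |r i|) * ⨆ i : ℤ, v i := by
  set M := D.sup' hD fun i => |r i|
  have hrM : ∀ i ∈ D, |r i| ≤ M := fun i hi => D.le_sup' (fun i => |r i|) hi
  have hM0 : 0 ≤ M := by
    obtain ⟨i, hi⟩ := hD
    exact (abs_nonneg _).trans (hrM i hi)
  have key (s : ℝ) (hs : |s| = 1) (j : ℤ) : 0 ≤ M * v j + s * e j := by
    have hasSum (j : ℤ) : HasSum (fun k : {k : ℤ // k ≠ 0} =>
        ((M * v j + s * e j) - (M * v (j - k) + s * e (j - k))) * w k)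
        (M * Lv j + s * r j) := by
      rw [hLv, hr]
      have h := ((summable_sub_mul_of_bounded hwpos hwsum hv j).hasSum.mul_left M).add
        ((summable_sub_mul_of_bounded hwpos hwsum he j).hasSum.mul_left s)
      refine (congrArg (HasSum · _) (funext fun k => ?_)).mp h
      ring
    refine nonneg_of_discrete_supersolution (u := fun j => M * v j + s * e j) hwpos hDc
      (fun i _ => (hasSum i).summable) (fun i hi => ?_) (fun i hi => ?_) j
    · rw [(hasSum i).tsum_eq]
      have h₁ : |s * r i| ≤ M := by rw [abs_mul, hs, one_mul]; exact hrM i hi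
      have h₂ : M * 1 ≤ M * Lv i := mul_le_mul_of_nonneg_left (hsuper i hi) hM0
      linarith [neg_abs_le (s * r i)]
    · simpa [heout i hi] using mul_nonneg hM0 (hvout i hi)
  intro j
  have hbdd : BddAbove (Set.range v) := by
    obtain ⟨C, hC⟩ := hv
    exact ⟨C, Set.forall_mem_range.mpr fun i => (le_abs_self _).trans (hC i)⟩
  refine le_trans ?_ (mul_le_mul_of_nonneg_left (le_ciSup hbdd j) hM0)
  rw [abs_le]
  constructor
  · linarith [key 1 (by simp) j]
  · linarith [key (-1) (by simp) j]
end

section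
/- For every α ∈ (0, 2) and every integer k ≥ 1, the Fourier cosine coefficient of the symbol (2 − 2cos ξ)^{α/2} = (2 sin(ξ/2))^α admits the closed form: ∫_0^π (2 sin(ξ/2))^α cos(kξ) dξ = −Γ(1+α)·sin(απ/2)·Γ(k − α/2) / Γ(k + 1 + α/2). Equivalently, the weights w_k^{PER} = −(1/π)∫_0^π (2 sin(ξ/2))^α cos(kξ) dξ equal Γ(k − α/2)·Γ(1+α)·sin(απ/2)/(π·Γ(k + 1 + α/2)). -/
open Real

/-- The real Beta integral. -/
lemma integral_Ioo_rpow_mul_one_sub_rpow {a b : ℝ} (ha : 0 < a) (hb : 0 < b) :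
    ∫ x in Set.Ioo (0 : ℝ) 1, x ^ (a - 1) * (1 - x) ^ (b - 1) =
      Gamma a * Gamma b / Gamma (a + b) := by
  change _ = ProbabilityTheory.beta a b
  rw [ProbabilityTheory.beta_eq_betaIntegralReal a b ha hb, Complex.betaIntegral,
    intervalIntegral.integral_of_le (by norm_num), ← MeasureTheory.integral_Ioc_eq_integral_Ioo,
    ← RCLike.re_to_complex, ← integral_re]
  · refine MeasureTheory.setIntegral_congr_fun measurableSet_Ioc fun x ⟨hx1, hx2⟩ ↦ ?_
    norm_cast
    rw [← Complex.ofReal_cpow, ← Complex.ofReal_cpow, RCLike.re_to_complex,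
      Complex.re_mul_ofReal, Complex.ofReal_re]
    all_goals linarith
  · convert! Complex.betaIntegral_convergent (u := a) (v := b) (by simpa) (by simpa)
    rw [intervalIntegrable_iff_integrableOn_Ioc_of_le (by simp), MeasureTheory.IntegrableOn]

lemma integral_sin_half_rpow {α : ℝ} (hα : -1 < α) :
    ∫ ξ in (0 : ℝ)..π, sin (ξ / 2) ^ α =
      Gamma ((α + 1) / 2) * √π / Gamma (α / 2 + 1) := by
  have hbeta := integral_Ioo_rpow_mul_one_sub_rpow (a := (α + 1) / 2) (b := 1 / 2)
    (by linarith) (by norm_num)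
  rw [Gamma_one_half_eq, show (α + 1) / 2 + 1 / 2 = α / 2 + 1 by ring] at hbeta
  have hsub := MeasureTheory.integral_Icc_deriv_smul_of_deriv_nonneg
    (f := fun ξ ↦ sin (ξ / 2) ^ 2) (f' := fun ξ ↦ sin (ξ / 2) * cos (ξ / 2)) (a := 0) (b := π)
    (g := fun x ↦ x ^ ((α + 1) / 2 - 1) * (1 - x) ^ ((1 : ℝ) / 2 - 1))
    (by fun_prop)
    (fun ξ _ ↦ by
      convert! ((hasDerivAt_id ξ).div_const 2).sin.pow 2 using 1
      simp
      ring)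
    (fun ξ hξ ↦ mul_nonneg
      (sin_nonneg_of_nonneg_of_le_pi (by linarith [hξ.1]) (by linarith [hξ.2, pi_pos]))
      (cos_nonneg_of_neg_pi_div_two_le_of_le (by linarith [hξ.1, pi_pos]) (by linarith [hξ.2])))
    pi_pos.le
  simp only [zero_div, sin_zero, sin_pi_div_two, one_pow, ne_eq, OfNat.ofNat_ne_zero,
    not_false_eq_true, zero_pow] at hsub
  rw [MeasureTheory.integral_Icc_eq_integral_Ioo, MeasureTheory.integral_Icc_eq_integral_Ioo,
    hbeta] at hsub
  rw [intervalIntegral.integral_of_le pi_pos.le, MeasureTheory.integral_Ioc_eq_integral_Ioo,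
    ← hsub]
  refine MeasureTheory.setIntegral_congr_fun measurableSet_Ioo fun ξ hξ ↦ ?_
  have hs : 0 < sin (ξ / 2) :=
    sin_pos_of_pos_of_lt_pi (by linarith [hξ.1]) (by linarith [hξ.2, pi_pos])
  have hc : 0 < cos (ξ / 2) :=
    cos_pos_of_mem_Ioo ⟨by linarith [hξ.1, pi_pos], by linarith [hξ.2]⟩
  simp only [smul_eq_mul]
  rw [← cos_sq', ← rpow_natCast, ← rpow_natCast, ← rpow_mul hs.le, ← rpow_mul hc.le,
    show ((2 : ℕ) : ℝ) * ((α + 1) / 2 - 1) = α - 1 by push_cast; ring,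
    show ((2 : ℕ) : ℝ) * (1 / 2 - 1) = -1 by norm_num, rpow_neg_one, rpow_sub_one hs.ne']
  field_simp

lemma integral_two_mul_sin_half_rpow {α : ℝ} (hα : -1 < α) :
    ∫ ξ in (0 : ℝ)..π, (2 * sin (ξ / 2)) ^ α = π * Gamma (1 + α) / Gamma (1 + α / 2) ^ 2 := by
  have hfac : ∫ ξ in (0 : ℝ)..π, (2 * sin (ξ / 2)) ^ α =
      ∫ ξ in (0 : ℝ)..π, 2 ^ α * sin (ξ / 2) ^ α := by
    refine intervalIntegral.integral_congr fun ξ hξ ↦ ?_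
    rw [Set.uIcc_of_le pi_pos.le] at hξ
    exact mul_rpow zero_le_two
      (sin_nonneg_of_nonneg_of_le_pi (by linarith [hξ.1]) (by linarith [hξ.2, pi_pos]))
  rw [hfac, intervalIntegral.integral_const_mul, integral_sin_half_rpow hα]
  have hdup := Gamma_mul_Gamma_add_half ((α + 1) / 2)
  rw [show (α + 1) / 2 + 1 / 2 = 1 + α / 2 by ring, show 2 * ((α + 1) / 2) = 1 + α by ring,
    show 1 - (1 + α) = -α by ring, rpow_neg zero_le_two] at hdup
  have hpos : 0 < Gamma (1 + α / 2) := Gamma_pos_of_pos (by linarith)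
  have h2 : (0 : ℝ) < 2 ^ α := rpow_pos_of_pos two_pos α
  have hpi : √π * √π = π := mul_self_sqrt pi_pos.le
  rw [add_comm (α / 2), ← mul_div_assoc, div_eq_div_iff hpos.ne' (by positivity)]
  calc 2 ^ α * (Gamma ((α + 1) / 2) * √π) * Gamma (1 + α / 2) ^ 2
      = 2 ^ α * √π * Gamma (1 + α / 2) * (Gamma ((α + 1) / 2) * Gamma (1 + α / 2)) := by ring
    _ = (√π * √π) * Gamma (1 + α) * Gamma (1 + α / 2) := by
        rw [hdup]
        field_simp
    _ = _ := by rw [hpi]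

lemma continuous_two_mul_sin_half_rpow_mul_cos {α : ℝ} (hα : 0 ≤ α) (c : ℝ) :
    Continuous fun ξ ↦ (2 * sin (ξ / 2)) ^ α * cos (c * ξ) :=
  (Continuous.rpow_const (by fun_prop) fun _ ↦ Or.inr hα).mul (by fun_prop)

lemma integral_two_mul_sin_half_rpow_mul_cos_succ {α : ℝ} (hα : 0 ≤ α) (k : ℕ) :
    (k + 1 + α / 2) * ∫ ξ in (0 : ℝ)..π, (2 * sin (ξ / 2)) ^ α * cos ((k + 1) * ξ) =
      (k - α / 2) * ∫ ξ in (0 : ℝ)..π, (2 * sin (ξ / 2)) ^ α * cos (k * ξ) := by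
  have hderiv : ∀ ξ ∈ Set.uIcc 0 π, HasDerivAt
      (fun ξ ↦ (2 * sin (ξ / 2)) ^ (α + 1) * cos ((k + 1 / 2) * ξ))
      ((k + 1 + α / 2) * ((2 * sin (ξ / 2)) ^ α * cos ((k + 1) * ξ)) -
        (k - α / 2) * ((2 * sin (ξ / 2)) ^ α * cos (k * ξ))) ξ := by
    intro ξ hξ
    rw [Set.uIcc_of_le pi_pos.le] at hξ
    have hs : 0 ≤ 2 * sin (ξ / 2) := mul_nonneg zero_le_two
      (sin_nonneg_of_nonneg_of_le_pi (by linarith [hξ.1]) (by linarith [hξ.2, pi_pos]))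
    have h1 := (((hasDerivAt_id ξ).div_const 2).sin.const_mul 2).rpow_const
      (p := α + 1) (Or.inr (by linarith))
    have h2 := ((hasDerivAt_id ξ).const_mul ((k : ℝ) + 1 / 2)).cos
    convert! h1.mul h2 using 1
    have hpow : (2 * sin (ξ / 2)) ^ (α + 1) = (2 * sin (ξ / 2)) ^ α * (2 * sin (ξ / 2)) := by
      rw [rpow_add_of_nonneg hs hα zero_le_one, rpow_one]
    simp only [id, add_sub_cancel_right, hpow]
    rw [show ((k : ℝ) + 1) * ξ = (k + 1 / 2) * ξ + ξ / 2 by ring,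
      show (k : ℝ) * ξ = (k + 1 / 2) * ξ - ξ / 2 by ring, cos_add, cos_sub]
    ring
  have hint (c : ℝ) : IntervalIntegrable (fun ξ ↦ (2 * sin (ξ / 2)) ^ α * cos (c * ξ))
      MeasureTheory.volume 0 π :=
    (continuous_two_mul_sin_half_rpow_mul_cos hα c).intervalIntegrable _ _
  have hftc := intervalIntegral.integral_eq_sub_of_hasDerivAt hderiv
    (((hint _).const_mul _).sub ((hint _).const_mul _))
  have hcos : cos (((k : ℝ) + 1 / 2) * π) = 0 :=
    cos_eq_zero_iff.mpr ⟨k, by push_cast; ring⟩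
  rw [intervalIntegral.integral_sub ((hint _).const_mul _) ((hint _).const_mul _),
    intervalIntegral.integral_const_mul, intervalIntegral.integral_const_mul, hcos, zero_div,
    sin_zero, mul_zero, mul_zero, zero_rpow (by linarith), zero_mul, sub_zero] at hftc
  exact sub_eq_zero.mp hftc

lemma sin_mul_Gamma_neg_mul_Gamma_one_add {s : ℝ} (hs : s ∈ Set.Ioo (0 : ℝ) 1) :
    sin (s * π) * Gamma (-s) * Gamma (1 + s) = -π := by
  have hsin : 0 < sin (s * π) := sin_pos_of_pos_of_lt_pi (mul_pos hs.1 pi_pos)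
    (by nlinarith [hs.2, pi_pos])
  have h := Gamma_mul_Gamma_one_sub (-s)
  rw [sub_neg_eq_add, mul_neg, sin_neg, mul_comm π s] at h
  rw [mul_assoc, h]
  field_simp

lemma integral_two_mul_sin_half_rpow_mul_cos {α : ℝ} (hα : α ∈ Set.Ioo (0 : ℝ) 2) (k : ℕ) :
    ∫ ξ in (0 : ℝ)..π, (2 * sin (ξ / 2)) ^ α * cos (k * ξ) =
      -(Gamma (1 + α) * sin (α * π / 2) * Gamma (k - α / 2) / Gamma (k + 1 + α / 2)) := by
  obtain ⟨h0, h2⟩ := hα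
  induction k with
  | zero =>
    have hpos : 0 < Gamma (1 + α / 2) := Gamma_pos_of_pos (by linarith)
    have hrefl := sin_mul_Gamma_neg_mul_Gamma_one_add (s := α / 2)
      ⟨by linarith, by linarith⟩
    simp only [Nat.cast_zero, zero_mul, cos_zero, mul_one, zero_sub, zero_add]
    rw [integral_two_mul_sin_half_rpow (by linarith), show α * π / 2 = α / 2 * π by ring,
      ← neg_div, div_eq_div_iff (by positivity) hpos.ne']
    linear_combination (Gamma (1 + α) * Gamma (1 + α / 2)) * hrefl
  | succ k ih =>
    have hne : (k : ℝ) - α / 2 ≠ 0 := by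
      rcases Nat.eq_zero_or_pos k with rfl | hk
      · simpa using h0.ne'
      · have : (1 : ℝ) ≤ k := by exact_mod_cast hk
        linarith
    have hpos : (0 : ℝ) < k + 1 + α / 2 := by positivity
    have hrec := integral_two_mul_sin_half_rpow_mul_cos_succ h0.le k
    rw [ih] at hrec
    push_cast
    rw [show (k : ℝ) + 1 - α / 2 = k - α / 2 + 1 by ring, Gamma_add_one hne,
      show (k : ℝ) + 1 + 1 + α / 2 = k + 1 + α / 2 + 1 by ring, Gamma_add_one hpos.ne']
    have hG := (Gamma_pos_of_pos hpos).ne'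
    apply mul_left_cancel₀ hpos.ne'
    rw [hrec]
    field_simp

/-- closed form of the Fourier cosine coefficients of the symbol
`(2sin(ξ/2))^α`:  for `α ∈ (0,2)` and integer `k ≥ 1`,
`∫_0^π (2sin(ξ/2))^α cos(kξ) dξ = -Γ(1+α)·sin(απ/2)·Γ(k-α/2)/Γ(k+1+α/2)`;
equivalently the weights `w_k^{PER} = -(1/π)∫_0^π (2sin(ξ/2))^α cos(kξ) dξ`
equal `Γ(k-α/2)·Γ(1+α)·sin(απ/2)/(π·Γ(k+1+α/2))`. -/
theorem per_weights_closed_form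
    (α : ℝ) (hα : α ∈ Set.Ioo (0 : ℝ) 2) (k : ℕ) (hk : 1 ≤ k) :
    (∫ ξ in (0:ℝ)..π, (2 * Real.sin (ξ / 2)) ^ α * Real.cos (k * ξ) =
      -(Real.Gamma (1 + α) * Real.sin (α * π / 2) *
          Real.Gamma ((k : ℝ) - α / 2) / Real.Gamma ((k : ℝ) + 1 + α / 2))) ∧
    (-(1 / π) * ∫ ξ in (0:ℝ)..π, (2 * Real.sin (ξ / 2)) ^ α * Real.cos (k * ξ) =
      Real.Gamma ((k : ℝ) - α / 2) * Real.Gamma (1 + α) * Real.sin (α * π / 2) /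
        (π * Real.Gamma ((k : ℝ) + 1 + α / 2))) := by
  have h := integral_two_mul_sin_half_rpow_mul_cos hα k
  refine ⟨h, ?_⟩
  have hG : Gamma ((k : ℝ) + 1 + α / 2) ≠ 0 :=
    (Gamma_pos_of_pos (by have := hα.1; positivity)).ne'
  rw [h]
  field_simp
end

section
/- For every α ∈ (0, 2), the symbol (2 sin(ξ/2))^α of the second-order scheme agrees with the exact symbol ξ^α to second order near the origin: lim_{ξ → 0+} ((2 sin(ξ/2))^α − ξ^α) / ξ^{α+2} = −α/24. In other words, (2 − 2cos ξ)^{α/2} = ξ^α·(1 − (α/24)·ξ² + o(ξ²)) as ξ → 0+, which shows the scheme with this symbol is second-order accurate. -/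
open Real Filter

theorem tendsto_two_mul_sin_half_sub_self_div_cube :
    Tendsto (fun ξ : ℝ => (2 * Real.sin (ξ / 2) - ξ) / ξ ^ 3)
      (nhdsWithin 0 (Set.Ioi 0)) (nhds (-1 / 24)) := by
  have hid : Tendsto (fun ξ : ℝ => ξ) (nhdsWithin 0 (Set.Ioi 0)) (nhds 0) :=
    tendsto_id.mono_left nhdsWithin_le_nhds
  rw [tendsto_iff_norm_sub_tendsto_zero]
  refine squeeze_zero' (Eventually.of_forall fun _ => norm_nonneg _) ?_ hid
  filter_upwards [Ioo_mem_nhdsGT (zero_lt_one (α := ℝ))] with ξ hξ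
  obtain ⟨h0, h1⟩ := hξ
  have hb := Real.sin_bound (x := ξ / 2) (by rw [abs_of_pos (by positivity)]; linarith)
  rw [abs_of_pos (show 0 < ξ / 2 by positivity)] at hb
  have h3 : 0 < ξ ^ 3 := by positivity
  have h4 : 0 < ξ ^ 4 := by positivity
  have h5 : ξ ^ 5 ≤ ξ ^ 4 := pow_le_pow_of_le_one h0.le h1.le (by norm_num)
  rw [show (2 * Real.sin (ξ / 2) - ξ) / ξ ^ 3 - -1 / 24
      = 2 * (Real.sin (ξ / 2) - (ξ / 2 - (ξ / 2) ^ 3 / 6)) / ξ ^ 3 by field_simp; ring,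
    Real.norm_eq_abs, abs_div, abs_mul, abs_of_pos h3, abs_two, div_le_iff₀ h3]
  linarith

/-- second-order consistency of the symbol `(2sin(ξ/2))^α`:
for `α ∈ (0,2)`, `lim_{ξ→0+} ((2sin(ξ/2))^α - ξ^α)/ξ^{α+2} = -α/24`. -/
theorem per_symbol_second_order
    (α : ℝ) (hα : α ∈ Set.Ioo (0 : ℝ) 2) :
    Filter.Tendsto
      (fun ξ : ℝ => ((2 * Real.sin (ξ / 2)) ^ α - ξ ^ α) / ξ ^ (α + 2))
      (nhdsWithin 0 (Set.Ioi 0)) (nhds (-α / 24)) := by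
  have hlim := tendsto_two_mul_sin_half_sub_self_div_cube
  have hid : Tendsto (fun ξ : ℝ => ξ) (nhdsWithin 0 (Set.Ioi 0)) (nhds 0) :=
    tendsto_id.mono_left nhdsWithin_le_nhds
  have hratio : Tendsto (fun ξ : ℝ => 2 * Real.sin (ξ / 2) / ξ)
      (nhdsWithin 0 (Set.Ioi 0)) (nhds 1) := by
    have h := (hlim.mul (hid.pow 2)).const_add 1
    rw [show (1 : ℝ) + -1 / 24 * 0 ^ 2 = 1 by norm_num] at h
    refine h.congr' ?_
    filter_upwards [self_mem_nhdsWithin] with ξ (hξ : 0 < ξ)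
    field_simp
    ring
  have hne : ∀ ξ : ℝ, 0 < ξ → 2 * Real.sin (ξ / 2) / ξ < 1 := fun ξ hξ => by
    rw [div_lt_one hξ]
    linarith [Real.sin_lt (half_pos hξ)]
  have hderiv : HasDerivAt (fun q : ℝ => q ^ α) α 1 := by
    simpa using Real.hasDerivAt_rpow_const (x := 1) (p := α) (Or.inl one_ne_zero)
  have hslope := (hasDerivAt_iff_tendsto_slope.mp hderiv).comp
    (tendsto_nhdsWithin_iff.mpr ⟨hratio, by
      filter_upwards [self_mem_nhdsWithin] with ξ hξ using (hne ξ hξ).ne⟩)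
  have h := hslope.mul hlim
  rw [show α * (-1 / 24) = -α / 24 by ring] at h
  refine h.congr' ?_
  filter_upwards [Ioo_mem_nhdsGT (zero_lt_one (α := ℝ))] with ξ ⟨h0, h1⟩
  have hsin : 0 < Real.sin (ξ / 2) :=
    Real.sin_pos_of_pos_of_lt_pi (half_pos h0) (by linarith [Real.pi_gt_three])
  have hq : 2 * Real.sin (ξ / 2) - ξ ≠ 0 :=
    ne_of_lt (by linarith [Real.sin_lt (half_pos h0)])
  have hp : 0 < ξ ^ α := Real.rpow_pos_of_pos h0 α
  simp only [Function.comp_apply, slope_def_field, Real.one_rpow]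
  rw [Real.div_rpow (by positivity) h0.le, Real.rpow_add h0, Real.rpow_two,
    show 2 * Real.sin (ξ / 2) / ξ - 1 = (2 * Real.sin (ξ / 2) - ξ) / ξ by field_simp]
  field_simp
end
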